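/- Let E be a real separable Banach space and P a Gaussian Borel probability measure on E whose mean is zero, i.e. ∫_E ω dP(ω) = 0, and with covariance kernel K(L₁,L₂) := ∫_E (L₁ω)(L₂ω) dP(ω). Let U : E → ℝ be Borel measurable with ∫_E U(ω)² dP(ω) < ∞, and suppose u := ∫_E ω U(ω) dP(ω) (Bochner integral). Let L, L₁,…,Lₙ ∈ E* with A_n := (K(L_j,L_k))_{j,k=1}^n positive definite, b_n(L) := (K(L,L₁),…,K(L,Lₙ))ᵀ, f_n := (L₁u,…,Lₙu)ᵀ, and σ_n(L) := (K(L,L) − b_n(L)ᵀA_n⁻¹b_n(L))^{1/2}. Then the kernel-based estimator s_n(L) := b_n(L)ᵀ A_n⁻¹ f_n satisfies |Lu − s_n(L)| ≤ (∫_E U² dP)^{1/2} σ_n(L). -/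

import Mathlib

open MeasureTheory ProbabilityTheory Matrix

/-- The Cauchy-Schwarz inequality for real square-integrable functions. -/
lemma abs_integral_mul_le_sqrt_mul_sqrt {Ω : Type*} [MeasurableSpace Ω] {μ : Measure Ω}
    {f g : Ω → ℝ} (hf : MemLp f 2 μ) (hg : MemLp g 2 μ) :
    |∫ x, f x * g x ∂μ| ≤ √(∫ x, f x ^ 2 ∂μ) * √(∫ x, g x ^ 2 ∂μ) := by
  have h := integral_mul_norm_le_Lp_mul_Lq (μ := μ) (f := f) (g := g) (p := 2) (q := 2)
    Real.HolderConjugate.two_two (by simpa using hf) (by simpa using hg)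
  simp only [Real.norm_eq_abs, Real.rpow_two, sq_abs, ← Real.sqrt_eq_rpow] at h
  refine (abs_integral_le_integral_abs).trans ?_
  simpa only [abs_mul] using h

/-- Expansion of the second moment of `f` against `g - ∑ i, c i * h i`. -/
lemma integral_sub_sum_mul {Ω ι : Type*} [Fintype ι] [MeasurableSpace Ω] {μ : Measure Ω}
    {f g : Ω → ℝ} {h : ι → Ω → ℝ} (c : ι → ℝ)
    (hf : MemLp f 2 μ) (hg : MemLp g 2 μ) (hh : ∀ i, MemLp (h i) 2 μ) :
    ∫ x, (g x - ∑ i, c i * h i x) * f x ∂μ =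
      ∫ x, g x * f x ∂μ - ∑ i, c i * ∫ x, h i x * f x ∂μ := by
  have hi (i : ι) : Integrable (fun x => c i * (h i x * f x)) μ :=
    ((hh i).integrable_mul hf).const_mul (c i)
  have hgf : Integrable (fun x => g x * f x) μ := hg.integrable_mul hf
  simp_rw [sub_mul, Finset.sum_mul, mul_assoc]
  rw [integral_sub hgf (integrable_finsetSum _ fun i _ => hi i),
    integral_finsetSum _ fun i _ => hi i]
  simp_rw [integral_const_mul]

/-- Error bound for the kernel-based estimator in the centered case.
`P` is a Gaussian Borel probability measure on a real separable Banach space with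
mean zero and covariance kernel `K(L₁,L₂) = ∫ (L₁ω)(L₂ω) dP`; `U ∈ L²(P)` and
`u = ∫ ω U(ω) dP(ω)`. Then `sₙ(T) = bₙ(T)ᵀAₙ⁻¹fₙ` satisfies
`|Tu − sₙ(T)| ≤ (∫U²dP)^{1/2} σₙ(T)` with `σₙ(T)² = K(T,T) − bₙ(T)ᵀAₙ⁻¹bₙ(T)`. -/
theorem kernel_estimator_error_bound_centered
    {E : Type*} [NormedAddCommGroup E] [NormedSpace ℝ E] [CompleteSpace E]
    [TopologicalSpace.SeparableSpace E] [MeasurableSpace E] [BorelSpace E]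
    (P : Measure E) [IsProbabilityMeasure P]
    (hGauss : ∀ L : E →L[ℝ] ℝ, ∃ (m : ℝ) (v : NNReal), P.map L = gaussianReal m v)
    (hmean : (∫ ω, ω ∂P) = 0)
    (K : (E →L[ℝ] ℝ) → (E →L[ℝ] ℝ) → ℝ)
    (hK : ∀ L₁ L₂ : E →L[ℝ] ℝ, K L₁ L₂ = ∫ ω, (L₁ ω) * (L₂ ω) ∂P)
    (U : E → ℝ) (hUmeas : Measurable U)
    (hU2 : Integrable (fun ω => U ω ^ 2) P)
    (u : E) (hu : u = ∫ ω, U ω • ω ∂P)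
    {n : ℕ} (T : E →L[ℝ] ℝ) (L : Fin n → (E →L[ℝ] ℝ))
    (A : Matrix (Fin n) (Fin n) ℝ) (hA : ∀ j k, A j k = K (L j) (L k))
    (hApd : A.PosDef)
    (b : Fin n → ℝ) (hb : ∀ i, b i = K T (L i)) :
    |T u - b ⬝ᵥ A⁻¹.mulVec (fun i => L i u)| ≤
      Real.sqrt (∫ ω, U ω ^ 2 ∂P) * Real.sqrt (K T T - b ⬝ᵥ A⁻¹.mulVec b) := by
  have hP : IsGaussian P := isGaussian_of_map_eq_gaussianReal hGauss
  have hL2 (M : E →L[ℝ] ℝ) : MemLp M 2 P := M.comp_memLp' IsGaussian.memLp_two_id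
  have hU : MemLp U 2 P := (memLp_two_iff_integrable_sq hUmeas.aestronglyMeasurable).2 hU2
  have hUint : Integrable (fun ω => U ω • ω) P :=
    memLp_one_iff_integrable.1 ((IsGaussian.memLp_two_id (μ := P)).smul hU)
  have hKsymm (M N : E →L[ℝ] ℝ) : K M N = K N M := by simp_rw [hK, mul_comm]
  have hAT : Aᵀ = A := by ext j k; simp only [transpose_apply, hA, hKsymm]
  have hAc : A *ᵥ (A⁻¹ *ᵥ b) = b := by
    rw [mulVec_mulVec, mul_nonsing_inv _ hApd.det_pos.ne'.isUnit, one_mulVec]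
  have hsymm (f : Fin n → ℝ) : b ⬝ᵥ A⁻¹ *ᵥ f = (A⁻¹ *ᵥ b) ⬝ᵥ f := by
    rw [dotProduct_mulVec, ← mulVec_transpose, transpose_nonsing_inv, hAT]
  rw [hsymm, hsymm]
  generalize A⁻¹ *ᵥ b = c at hAc
  let M : E →L[ℝ] ℝ := T - ∑ i, c i • L i
  have hM (ω : E) : M ω = T ω - ∑ i, c i * L i ω := by simp [M]
  have hMN (N : E →L[ℝ] ℝ) : ∫ ω, M ω * N ω ∂P = K T N - ∑ i, c i * K (L i) N := by
    simp_rw [hM, hK]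
    exact integral_sub_sum_mul c (hL2 N) (hL2 T) fun i => hL2 (L i)
  have hML (i : Fin n) : ∫ ω, L i ω * M ω ∂P = 0 := by
    simp_rw [mul_comm (L i _)]
    rw [hMN, ← hb, ← congrFun hAc i, sub_eq_zero]
    simp only [mulVec, dotProduct, hA, hKsymm (L i), mul_comm]
  have hMM : ∫ ω, M ω ^ 2 ∂P = K T T - c ⬝ᵥ b := by
    calc ∫ ω, M ω ^ 2 ∂P = ∫ ω, (T ω - ∑ i, c i * L i ω) * M ω ∂P := by
          simp_rw [← hM, sq]
      _ = ∫ ω, M ω * T ω ∂P := by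
          rw [integral_sub_sum_mul c (hL2 M) (hL2 T) fun i => hL2 (L i)]
          simp [hML, mul_comm]
      _ = K T T - c ⬝ᵥ b := by
          simp only [hMN, dotProduct, hb, hKsymm (L _)]
  have hMu : T u - c ⬝ᵥ (fun i => L i u) = ∫ ω, U ω * M ω ∂P := by
    rw [dotProduct, ← hM, hu, ← M.integral_comp_comm hUint]
    simp
  rw [hMu, ← hMM]
  exact abs_integral_mul_le_sqrt_mul_sqrt hU (hL2 M)
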